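/- Let L be a natural number and S a nonempty finite set of natural numbers all less than 2^L, and let C 0, C 1, …, C L be the season elimination process on S. Then every element x ∈ S with x < max S satisfies x ∉ C L; that is, every node whose ID is not the largest is eliminated by the end of the season. -/

import Mathlib

/-- One step of the season elimination process: at step `k` (bit position `L - 1 - k`,
most significant bit first), the candidates whose bit is `1` eliminate those whose bit
is `0`; if no candidate has bit `1`, the candidate set is unchanged. -/
def seasonStep (L k : ℕ) (C : Finset ℕ) : Finset ℕ :=
  let C' := C.filter fun x => Nat.testBit x (L - 1 - k) = true
  if C'.Nonempty then C' else C

/-- The season elimination process on a finite set `S` of `L`-bit identifiers: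
`seasonProcess L S 0 = S` and `seasonProcess L S (k+1)` is obtained from
`seasonProcess L S k` by one elimination step on bit `L - 1 - k`. -/
def seasonProcess (L : ℕ) (S : Finset ℕ) : ℕ → Finset ℕ
  | 0 => S
  | k + 1 => seasonStep L k (seasonProcess L S k)

theorem seasonProcess_invariant (L : ℕ) (S : Finset ℕ) (m : ℕ) (hm : m ∈ S)
    (hmax : ∀ x ∈ S, x ≤ m) (hlt : ∀ x ∈ S, x < 2 ^ L) (k : ℕ) (hk : k ≤ L) :
    m ∈ seasonProcess L S k ∧
      ∀ x ∈ seasonProcess L S k, x ∈ S ∧ x / 2 ^ (L - k) = m / 2 ^ (L - k) := by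
  induction k with
  | zero =>
    refine ⟨hm, fun x hx => ⟨hx, ?_⟩⟩
    have hx' : x ∈ S := hx
    rw [Nat.sub_zero, Nat.div_eq_of_lt (hlt x hx'), Nat.div_eq_of_lt (hlt m hm)]
  | succ k ih =>
    obtain ⟨h1, h2⟩ := ih (by omega)
    obtain ⟨j, hj⟩ : ∃ j, L - 1 - k = j := ⟨_, rfl⟩
    have e1 : L - k = j + 1 := by omega
    have e2 : L - (k + 1) = j := by omega
    rw [e1] at h2
    simp only [pow_succ, ← Nat.div_div_eq_div_mul] at h2
    rw [e2]
    simp only [seasonProcess, seasonStep, hj]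
    have hb : ∀ x, Nat.testBit x j = true ↔ x / 2 ^ j % 2 = 1 := by
      intro x
      rw [Nat.testBit_eq_decide_div_mod_eq, decide_eq_true_iff]
    split_ifs with hne
    · obtain ⟨y, hy⟩ := hne
      rw [Finset.mem_filter, hb] at hy
      have hy2 := h2 y hy.1
      have hle : y / 2 ^ j ≤ m / 2 ^ j := Nat.div_le_div_right (hmax y hy2.1)
      have hmb : m / 2 ^ j % 2 = 1 := by omega
      refine ⟨Finset.mem_filter.2 ⟨h1, (hb m).2 hmb⟩, fun x hx => ?_⟩
      rw [Finset.mem_filter, hb] at hx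
      have hx2 := h2 x hx.1
      exact ⟨hx2.1, by omega⟩
    · have hn : ∀ x ∈ seasonProcess L S k, ¬ x / 2 ^ j % 2 = 1 := fun x hx hc =>
        hne ⟨x, Finset.mem_filter.2 ⟨hx, (hb x).2 hc⟩⟩
      refine ⟨h1, fun x hx => ?_⟩
      have hx2 := h2 x hx
      have := hn x hx
      have := hn m h1
      exact ⟨hx2.1, by omega⟩

/-- In the season elimination process on a nonempty set `S` of naturals below `2^L`,
every element of `S` other than the maximum is eliminated by the end of the season:
it does not belong to the final candidate set. -/
theorem seasonProcess_eliminates_non_max (L : ℕ) (S : Finset ℕ) (hS : S.Nonempty)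
    (hlt : ∀ x ∈ S, x < 2 ^ L) :
    ∀ x ∈ S, x < S.max' hS → x ∉ seasonProcess L S L := by
  intro x _ hxm hxC
  have h := ((seasonProcess_invariant L S (S.max' hS) (S.max'_mem hS)
    (fun y hy => S.le_max' y hy) hlt L le_rfl).2 x hxC).2
  simp only [Nat.sub_self, pow_zero, Nat.div_one] at h
  omega
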